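/- arXiv:1312.6757 — 5 statements merged into one kernel-verified Lean document; each statement's English description precedes it below -/
import Mathlib

section
/- Let (X, 𝓕, P) be a probability space, Ω and Θ nonempty sets, π : Ω → Θ a map, E : X → Θ a map, and for each x ∈ X let d^x : Θ × Θ → [0,∞) be a semi-distance on Θ. Fix γ ∈ (0,1) and assume that for every ω ∈ Ω the function x ↦ d^x(E(x), π(ω)) is measurable. For ω ∈ Ω define η^γ_ω = inf { η > 0 : P({x : d^x(E(x), π(ω)) ≤ η}) ≥ γ }, and for x ∈ X define the confidence region D^γ_x = { π(ω) : ω ∈ Ω, d^x(E(x), π(ω)) ≤ η^γ_ω } ⊆ Θ. Then for every ω₀ ∈ Ω, the outer measure of the set {x ∈ X : π(ω₀) ∈ D^γ_x} is at least γ. -/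
open MeasureTheory

/-- the confidence region `D^γ_x` covers the true quantity `π(ω₀)`
with (outer) probability at least `γ`. -/
theorem confidence_region_coverage
    {X : Type*} [MeasurableSpace X] (P : Measure X) [IsProbabilityMeasure P]
    {Ω Θ : Type*} [Nonempty Ω] [Nonempty Θ]
    (π : Ω → Θ) (E : X → Θ) (d : X → Θ → Θ → ℝ)
    (hd_nonneg : ∀ x θ₁ θ₂, 0 ≤ d x θ₁ θ₂)
    (hd_refl : ∀ x θ, d x θ θ = 0)
    (hd_symm : ∀ x θ₁ θ₂, d x θ₁ θ₂ = d x θ₂ θ₁)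
    (hd_tri : ∀ x θ₁ θ₂ θ₃, d x θ₁ θ₃ ≤ d x θ₁ θ₂ + d x θ₂ θ₃)
    (γ : ℝ) (hγ : γ ∈ Set.Ioo (0 : ℝ) 1)
    (hmeas : ∀ ω : Ω, Measurable fun x => d x (E x) (π ω))
    (η : Ω → ℝ)
    (hη : ∀ ω : Ω, η ω = sInf {η' : ℝ | 0 < η' ∧
      ENNReal.ofReal γ ≤ P {x | d x (E x) (π ω) ≤ η'}})
    (D : X → Set Θ)
    (hD : ∀ x : X, D x = {θ : Θ | ∃ ω : Ω, π ω = θ ∧ d x (E x) (π ω) ≤ η ω}) :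
    ∀ ω₀ : Ω, ENNReal.ofReal γ ≤ P {x | π ω₀ ∈ D x} := by
  intro ω₀
  set f : X → ℝ := fun x => d x (E x) (π ω₀) with hf
  have hfm : Measurable f := hmeas ω₀
  have hsub : {x | f x ≤ η ω₀} ⊆ {x | π ω₀ ∈ D x} := by
    intro x hx
    simp only [Set.mem_setOf_eq, hD]
    exact ⟨ω₀, rfl, hx⟩
  refine le_trans ?_ (measure_mono hsub)
  set S : Set ℝ := {η' : ℝ | 0 < η' ∧ ENNReal.ofReal γ ≤ P {x | f x ≤ η'}} with hS
  have hη0 : η ω₀ = sInf S := hη ω₀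
  have hne : S.Nonempty := by
    have hmono : Monotone (fun n : ℕ => {x | f x ≤ (n : ℝ) + 1}) := by
      intro m n hmn x hx
      have h : (m : ℝ) ≤ n := by exact_mod_cast hmn
      simp only [Set.mem_setOf_eq] at hx ⊢
      linarith
    have hT := tendsto_measure_iUnion_atTop (μ := P) hmono
    have hU : (⋃ n : ℕ, {x | f x ≤ (n : ℝ) + 1}) = Set.univ := by
      ext x
      obtain ⟨n, hn⟩ := exists_nat_ge (f x)
      simp only [Set.mem_iUnion, Set.mem_setOf_eq, Set.mem_univ, iff_true]
      exact ⟨n, by linarith⟩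
    rw [hU, measure_univ] at hT
    have hlt : ENNReal.ofReal γ < 1 := by
      rw [← ENNReal.ofReal_one]
      exact (ENNReal.ofReal_lt_ofReal_iff one_pos).2 hγ.2
    obtain ⟨n, hn⟩ := (hT.eventually (lt_mem_nhds hlt)).exists
    exact ⟨(n : ℝ) + 1, by positivity, hn.le⟩
  have hstep : ∀ n : ℕ, ENNReal.ofReal γ ≤ P {x | f x ≤ η ω₀ + 1 / ((n : ℝ) + 1)} := by
    intro n
    have hpos : (0 : ℝ) < 1 / ((n : ℝ) + 1) := by positivity
    obtain ⟨a, ha, hlt⟩ := exists_lt_of_csInf_lt hne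
      (show sInf S < η ω₀ + 1 / ((n : ℝ) + 1) by rw [hη0]; linarith)
    refine ha.2.trans (measure_mono ?_)
    intro x hx
    exact le_trans hx hlt.le
  have hanti : Antitone (fun n : ℕ => {x | f x ≤ η ω₀ + 1 / ((n : ℝ) + 1)}) := by
    intro m n hmn x hx
    have h := Nat.one_div_le_one_div (α := ℝ) hmn
    simp only [Set.mem_setOf_eq] at hx ⊢
    linarith
  have hT := tendsto_measure_iInter_atTop (μ := P)
    (fun n => (measurableSet_le hfm measurable_const).nullMeasurableSet) hanti
    ⟨0, measure_ne_top _ _⟩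
  have hI : (⋂ n : ℕ, {x | f x ≤ η ω₀ + 1 / ((n : ℝ) + 1)}) = {x | f x ≤ η ω₀} := by
    ext x
    simp only [Set.mem_iInter, Set.mem_setOf_eq]
    constructor
    · intro h
      refine le_of_forall_pos_le_add fun ε hε => ?_
      obtain ⟨n, hn⟩ := exists_nat_one_div_lt hε
      linarith [h n]
    · intro h n
      have hpos : (0 : ℝ) < 1 / ((n : ℝ) + 1) := by positivity
      linarith
  rw [hI] at hT
  exact ge_of_tendsto' hT hstep
end

section
/- Let n ≥ 2, μ ∈ ℝ, σ > 0, and let N^n_{(μ,σ)} be the n-fold product on ℝⁿ of the normal distribution N(μ,σ²). Then for every Borel set Ξ ⊆ (0,∞), N^n_{(μ,σ)}({x ∈ ℝⁿ : S̄(x) ∈ Ξ}) = ∫_{Ξ/σ²} p^{χ²}_{n−1}(x) dx, where Ξ/σ² = { t/σ² : t ∈ Ξ }; that is, S̄(x)/σ² is chi-squared distributed with n−1 degrees of freedom under N^n_{(μ,σ)}. -/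
open MeasureTheory ProbabilityTheory

/-- The chi-squared density with `m` degrees of freedom. -/
noncomputable def chiSqPDF (m : ℕ) (x : ℝ) : ℝ :=
  x ^ ((m : ℝ) / 2 - 1) * Real.exp (-x / 2) /
    (2 ^ ((m : ℝ) / 2) * Real.Gamma ((m : ℝ) / 2))

lemma pi_gauss_density (m : ℕ) :
    (Measure.pi fun _ : Fin m => gaussianReal 0 1) =
      (volume : Measure (Fin m → ℝ)).withDensity
        (fun x => ENNReal.ofReal (∏ i, gaussianPDFReal 0 1 (x i))) := by
  symm
  apply (Measure.pi_eq ?_).symm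
  intro s hs
  have hint : ∀ i, Integrable (gaussianPDFReal 0 1) (volume.restrict (s i)) :=
    fun i => (integrable_gaussianPDFReal 0 1).restrict
  rw [withDensity_apply _ (MeasurableSet.univ_pi hs), volume_pi, Measure.restrict_pi_pi,
    ← ofReal_integral_eq_lintegral_ofReal (Integrable.fintype_prod hint)
      (Filter.Eventually.of_forall fun x =>
        Finset.prod_nonneg fun i _ => gaussianPDFReal_nonneg 0 1 _),
    integral_fintype_prod_eq_prod (fun _ => gaussianPDFReal 0 1),
    ENNReal.ofReal_prod_of_nonneg]
  · refine Finset.prod_congr rfl fun i _ => ?_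
    rw [gaussianReal_apply_eq_integral _ one_ne_zero]
  · intro i _
    exact integral_nonneg fun x => gaussianPDFReal_nonneg 0 1 _

lemma const_id (m : ℕ) (hm : 1 ≤ m) (y : ℝ) (hy : 0 < y) :
    (m : ℝ) * (√Real.pi ^ m / Real.Gamma ((m : ℝ) / 2 + 1)) *
      (y ^ (m - 1) * ((√(2 * Real.pi))⁻¹ ^ m * Real.exp (-y ^ 2 / 2))) =
    2 * y ^ ((2 : ℝ) - 1) * chiSqPDF m (y ^ (2 : ℝ)) := by
  have hm0 : (0 : ℝ) < m := by exact_mod_cast hm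
  have hG : 0 < Real.Gamma ((m : ℝ) / 2) := Real.Gamma_pos_of_pos (by positivity)
  have h2 : (2 : ℝ) ^ ((m : ℝ) / 2) = √2 ^ m := by
    rw [Real.sqrt_eq_rpow, ← Real.rpow_natCast, ← Real.rpow_mul (by norm_num)]
    congr 1; ring
  have hyy : (y ^ (2 : ℝ)) ^ ((m : ℝ) / 2 - 1) * y = y ^ (m - 1) := by
    rw [← Real.rpow_mul hy.le, ← Real.rpow_natCast y (m - 1), Nat.cast_sub hm]
    nth_rewrite 2 [← Real.rpow_one y]
    rw [← Real.rpow_add hy]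
    congr 1; push_cast; ring
  unfold chiSqPDF
  rw [Real.Gamma_add_one (by positivity), h2, ← hyy, show (2 : ℝ) - 1 = 1 by norm_num,
    Real.rpow_one, Real.rpow_two, Real.sqrt_mul (by norm_num), inv_pow, mul_pow]
  have : 0 < √Real.pi := Real.sqrt_pos.2 Real.pi_pos
  field_simp

lemma chiSq_law (m : ℕ) (hm : 1 ≤ m) (A : Set ℝ) (hA : A ⊆ Set.Ioi 0) (hAm : MeasurableSet A) :
    (Measure.pi fun _ : Fin m => gaussianReal 0 1) {y | ∑ i, y i ^ 2 ∈ A} =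
      ENNReal.ofReal (∫ t in A, chiSqPDF m t) := by
  have : Nonempty (Fin m) := ⟨⟨0, hm⟩⟩
  have hBm : MeasurableSet {y : Fin m → ℝ | ∑ i, y i ^ 2 ∈ A} := by
    apply hAm.preimage
    fun_prop
  have hint : Integrable (fun x : Fin m → ℝ => ∏ i, gaussianPDFReal 0 1 (x i)) :=
    Integrable.fintype_prod fun i => integrable_gaussianPDFReal 0 1
  rw [pi_gauss_density, withDensity_apply _ hBm,
    ← ofReal_integral_eq_lintegral_ofReal hint.restrict
      (Filter.Eventually.of_forall fun x =>
        Finset.prod_nonneg fun i _ => gaussianPDFReal_nonneg 0 1 _)]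
  congr 1
  let f : ℝ → ℝ := fun r => A.indicator (fun _ => (√(2 * Real.pi))⁻¹ ^ m * Real.exp (-r ^ 2 / 2)) (r ^ 2)
  have h1 : ∫ x in {y : Fin m → ℝ | ∑ i, y i ^ 2 ∈ A}, ∏ i, gaussianPDFReal 0 1 (x i) =
      ∫ x : EuclideanSpace ℝ (Fin m), f ‖x‖ := by
    rw [← integral_indicator hBm,
      ← (PiLp.volume_preserving_toLp (Fin m)).integral_comp
        (MeasurableEquiv.toLp 2 (Fin m → ℝ)).measurableEmbedding]
    congr 1
    ext x
    simp only [f, EuclideanSpace.real_norm_sq_eq]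
    by_cases hx : ∑ i, x i ^ 2 ∈ A
    · rw [Set.indicator_of_mem (by exact hx), Set.indicator_of_mem (by exact hx)]
      simp only [gaussianPDFReal, Finset.prod_mul_distrib, ← Real.exp_sum]
      simp [Finset.sum_div, neg_div]
    · rw [Set.indicator_of_notMem (by exact hx), Set.indicator_of_notMem (by exact hx)]
  rw [h1, integral_fun_norm_addHaar, ← integral_indicator hAm]
  have h2 : ∫ t, A.indicator (chiSqPDF m) t = ∫ t in Set.Ioi 0, A.indicator (chiSqPDF m) t := by
    rw [setIntegral_eq_integral_of_forall_compl_eq_zero]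
    intro x hx
    exact Set.indicator_of_notMem (fun h => hx (hA h)) _
  rw [h2, ← integral_comp_rpow_Ioi_of_pos (g := A.indicator (chiSqPDF m)) (p := 2) two_pos]
  rw [Measure.real, EuclideanSpace.volume_ball]
  simp only [finrank_euclideanSpace, Fintype.card_fin, ENNReal.ofReal_one, one_pow, one_mul]
  rw [ENNReal.toReal_ofReal (by positivity), nsmul_eq_mul, smul_eq_mul, ← mul_assoc,
    ← integral_const_mul]
  refine setIntegral_congr_fun measurableSet_Ioi fun y hy => ?_
  have := const_id m hm y hy
  simp only [f, smul_eq_mul]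
  by_cases hx : y ^ 2 ∈ A
  · rw [Set.indicator_of_mem hx, Set.indicator_of_mem (by rw [Real.rpow_two]; exact hx), this]
  · rw [Set.indicator_of_notMem hx, Set.indicator_of_notMem (by rw [Real.rpow_two]; exact hx)]
    simp

lemma var_identity (m : ℕ) : ∃ b : OrthonormalBasis (Fin (m+1)) ℝ (EuclideanSpace ℝ (Fin (m+1))),
    ∀ y : Fin (m+1) → ℝ, ∀ x : EuclideanSpace ℝ (Fin (m+1)), x = ∑ i, y i • b i →
      ∑ k, (x k - (∑ j, x j) / ((m + 1 : ℕ) : ℝ)) ^ 2 = ∑ i : Fin m, y i.succ ^ 2 := by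
  have hpos : (0 : ℝ) < (m + 1 : ℕ) := by positivity
  let u : EuclideanSpace ℝ (Fin (m+1)) := WithLp.toLp 2 fun _ => (√((m + 1 : ℕ) : ℝ))⁻¹
  have hu : ‖u‖ = 1 := by
    rw [EuclideanSpace.norm_eq, Real.sqrt_eq_one]
    simp only [u, Real.norm_eq_abs, sq_abs, inv_pow, Real.sq_sqrt hpos.le]
    simp
    field_simp
  obtain ⟨b, hb⟩ := Orthonormal.exists_orthonormalBasis_extension_of_card_eq (𝕜 := ℝ)
    (E := EuclideanSpace ℝ (Fin (m+1))) (ι := Fin (m+1)) (by simp) (v := fun _ => u) (s := {0})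
    (by
      refine ⟨fun i => hu, fun i j hij => (hij (Subsingleton.elim _ _)).elim⟩)
  refine ⟨b, fun y x hx => ?_⟩
  have hb0 : b 0 = u := hb 0 rfl
  have hy0 : inner ℝ u x = y 0 := by
    rw [← hb0, hx]
    exact b.orthonormal.inner_right_fintype y 0
  have hn : ∑ k, x k ^ 2 = ∑ i, y i ^ 2 := by
    rw [← EuclideanSpace.real_norm_sq_eq, hx, ← real_inner_self_eq_norm_sq,
      b.orthonormal.inner_sum]
    simp [sq]
  have hin : inner ℝ u x = (√((m + 1 : ℕ) : ℝ))⁻¹ * ∑ j, x j := by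
    simp only [u, PiLp.inner_apply, Finset.mul_sum]
    exact Finset.sum_congr rfl fun i _ => mul_comm _ _
  have hy2 : y 0 ^ 2 = (∑ j, x j) ^ 2 / ((m + 1 : ℕ) : ℝ) := by
    rw [← hy0, hin, mul_pow, inv_pow, Real.sq_sqrt hpos.le]
    field_simp
  have hexp : ∑ k, (x k - (∑ j, x j) / ((m + 1 : ℕ) : ℝ)) ^ 2 =
      ∑ k, x k ^ 2 - (∑ j, x j) ^ 2 / ((m + 1 : ℕ) : ℝ) := by
    set S := ∑ j, x j
    simp only [sub_sq, Finset.sum_add_distrib, Finset.sum_sub_distrib, ← Finset.sum_mul,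
      ← Finset.mul_sum, Finset.sum_const, Finset.card_univ, Fintype.card_fin, nsmul_eq_mul]
    change _ - 2 * S * _ + _ = _
    field_simp
    ring
  rw [hexp, ← hy2, hn, Fin.sum_univ_succ]
  ring

lemma std_case (m : ℕ) (hm : 1 ≤ m) (A : Set ℝ) (hA : A ⊆ Set.Ioi 0) (hAm : MeasurableSet A) :
    (Measure.pi fun _ : Fin (m+1) => gaussianReal 0 1)
        {x : Fin (m+1) → ℝ | (∑ k, (x k - (∑ j, x j) / ((m + 1 : ℕ) : ℝ)) ^ 2) ∈ A}
      = ENNReal.ofReal (∫ t in A, chiSqPDF m t) := by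
  obtain ⟨b, hb⟩ := var_identity m
  have hTm : MeasurableSet {x : EuclideanSpace ℝ (Fin (m+1)) |
      (∑ k, (x k - (∑ j, x j) / ((m + 1 : ℕ) : ℝ)) ^ 2) ∈ A} := by
    apply hAm.preimage
    fun_prop
  have h1 := congrArg (fun ν => ν {x : EuclideanSpace ℝ (Fin (m+1)) |
      (∑ k, (x k - (∑ j, x j) / ((m + 1 : ℕ) : ℝ)) ^ 2) ∈ A})
      ((map_pi_eq_stdGaussian (ι := Fin (m+1))).trans (stdGaussian_eq_map_pi_orthonormalBasis b))
  simp only at h1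
  rw [Measure.map_apply (by fun_prop) hTm, Measure.map_apply (by fun_prop) hTm] at h1
  refine h1.trans ?_
  rw [← chiSq_law m hm A hA hAm]
  have hBm : MeasurableSet {y : Fin m → ℝ | ∑ i, y i ^ 2 ∈ A} := by
    apply hAm.preimage
    fun_prop
  have hmp := (measurePreserving_snd (μ := gaussianReal 0 1)
    (ν := Measure.pi fun _ : Fin m => gaussianReal 0 1)).comp
    (measurePreserving_piFinSuccAbove (fun _ : Fin (m+1) => gaussianReal 0 1) 0)
  rw [← hmp.measure_preimage hBm.nullMeasurableSet]
  congr 1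
  ext y
  simp only [Set.mem_preimage, Set.mem_ofPred_eq]
  rw [hb y _ rfl]
  rfl

/-- `S̄(x)/σ²` is chi-squared distributed with `n - 1` degrees of
freedom under the `n`-fold product of `N(μ, σ²)`. -/
theorem sample_variance_chiSq
    (n : ℕ) (hn : 2 ≤ n) (μ σ : ℝ) (hσ : 0 < σ)
    (Ξ : Set ℝ) (hΞ : Ξ ⊆ Set.Ioi (0 : ℝ)) (hΞm : MeasurableSet Ξ) :
    (Measure.pi fun _ : Fin n => gaussianReal μ (Real.toNNReal (σ ^ 2)))
        {x : Fin n → ℝ | (∑ k, (x k - (∑ j, x j) / n) ^ 2) ∈ Ξ}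
      = ENNReal.ofReal (∫ t in (fun t : ℝ => t / σ ^ 2) '' Ξ, chiSqPDF (n - 1) t) := by
  obtain ⟨m, rfl⟩ : ∃ m, n = m + 1 := ⟨n - 1, by omega⟩
  have hσ2 : (0 : ℝ) < σ ^ 2 := by positivity
  have himg : (fun t : ℝ => t / σ ^ 2) '' Ξ = (fun t : ℝ => σ ^ 2 * t) ⁻¹' Ξ := by
    ext t
    constructor
    · rintro ⟨s, hs, rfl⟩
      simpa [mul_div_cancel₀ _ hσ2.ne'] using hs
    · intro ht
      exact ⟨_, ht, by field_simp⟩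
  have hmap : gaussianReal μ (Real.toNNReal (σ ^ 2)) =
      (gaussianReal 0 1).map (fun x => μ + σ * x) := by
    have : (fun x : ℝ => μ + σ * x) = (fun x => μ + x) ∘ (fun x => σ * x) := rfl
    rw [this, ← Measure.map_map (by fun_prop) (by fun_prop), gaussianReal_map_const_mul,
      gaussianReal_map_const_add]
    congr 1
    · simp
    · ext; simp [hσ2.le]
  rw [himg, Nat.add_sub_cancel, ← std_case m (by omega)]
  · have hsf : IsProbabilityMeasure ((gaussianReal 0 1).map (fun x => μ + σ * x)) :=
      Measure.isProbabilityMeasure_map (by fun_prop)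
    rw [hmap, ← Measure.pi_map_pi (μ := fun _ : Fin (m + 1) => gaussianReal 0 1)
      (f := fun _ x => μ + σ * x) (fun _ => by fun_prop), Measure.map_apply (by fun_prop)]
    · congr 1
      ext x
      simp only [Set.mem_preimage, Set.mem_ofPred_eq]
      rw [Finset.mul_sum]
      have hpos : ((m + 1 : ℕ) : ℝ) ≠ 0 := by positivity
      have : ∀ k, (μ + σ * x k - (∑ j, (μ + σ * x j)) / ((m + 1 : ℕ) : ℝ)) ^ 2 =
          σ ^ 2 * (x k - (∑ j, x j) / ((m + 1 : ℕ) : ℝ)) ^ 2 := by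
        intro k
        rw [Finset.sum_add_distrib, ← Finset.mul_sum]
        simp only [Finset.sum_const, Finset.card_univ, Fintype.card_fin, nsmul_eq_mul]
        field_simp
        ring
      simp only [this]
    · apply hΞm.preimage
      fun_prop
  · intro t ht
    have := hΞ ht
    simp only [Set.mem_Ioi] at this ⊢
    exact pos_of_mul_pos_right this hσ2.le
  · exact hΞm.preimage (by fun_prop)
end

section
/- Let n ≥ 2, μ ∈ ℝ, σ > 0, η > 0, and let N^n_{(μ,σ)} be the n-fold product on ℝⁿ of the normal distribution N(μ,σ²). Then N^n_{(μ,σ)}({x ∈ ℝⁿ : √n·|μ̄(x) − μ| / σ̄'(x) ≤ η}) = ∫_{−η}^{η} p^t_{n−1}(x) dx, where σ̄'(x) = √(S̄(x)/(n−1)) and p^t_m is the density of Student's t-distribution with m degrees of freedom. In particular this probability does not depend on (μ,σ). -/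
open MeasureTheory ProbabilityTheory

/-- Student's t-density with `m` degrees of freedom. -/
noncomputable def tPDF (m : ℕ) (x : ℝ) : ℝ :=
  Real.Gamma (((m : ℝ) + 1) / 2) /
      (Real.sqrt (m * Real.pi) * Real.Gamma ((m : ℝ) / 2)) *
    (1 + x ^ 2 / m) ^ (-((m : ℝ) + 1) / 2)

lemma st_norm_integral (m : ℕ) (hm : 1 ≤ m) (b : ℝ) (hb : 0 < b) :
    ∫ w : EuclideanSpace ℝ (Fin m), ‖w‖ * Real.exp (-b * ‖w‖ ^ 2) =
      Real.sqrt Real.pi ^ m / Real.Gamma ((m : ℝ) / 2) * b ^ (-((m : ℝ) + 1) / 2)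
        * Real.Gamma (((m : ℝ) + 1) / 2) := by
  have : Nonempty (Fin m) := ⟨⟨0, hm⟩⟩
  have hmR : (0 : ℝ) < m := by exact_mod_cast hm
  have h := integral_fun_norm_addHaar (volume : Measure (EuclideanSpace ℝ (Fin m)))
    (fun y => y * Real.exp (-b * y ^ 2))
  have h2 := integral_rpow_mul_exp_neg_mul_rpow (p := 2) (q := m) (b := b) (by norm_num)
    (by linarith) hb
  have h3 : ∫ y in Set.Ioi (0 : ℝ), y ^ (m - 1) • (y * Real.exp (-b * y ^ 2)) =
      ∫ x in Set.Ioi (0 : ℝ), x ^ (m : ℝ) * Real.exp (-b * x ^ (2 : ℝ)) := by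
    refine setIntegral_congr_fun measurableSet_Ioi (fun y hy => ?_)
    simp only [Real.rpow_natCast, Real.rpow_ofNat, smul_eq_mul]
    rw [← mul_assoc, ← pow_succ, Nat.sub_add_cancel hm]
  rw [h]
  simp only [finrank_euclideanSpace, Fintype.card_fin]
  rw [h3, h2]
  have hG : Real.Gamma ((m : ℝ) / 2 + 1) = m / 2 * Real.Gamma ((m : ℝ) / 2) :=
    Real.Gamma_add_one (by positivity)
  have hGp : 0 < Real.Gamma ((m : ℝ) / 2) := Real.Gamma_pos_of_pos (by positivity)
  rw [Measure.real, EuclideanSpace.volume_ball]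
  simp only [Fintype.card_fin, ENNReal.ofReal_one, one_pow, one_mul, hG]
  rw [ENNReal.toReal_ofReal (by positivity)]
  simp only [smul_eq_mul, nsmul_eq_mul]
  field_simp

lemma st_pi_density (m : ℕ) :
    (Measure.pi fun _ : Fin m => gaussianReal 0 1) =
      volume.withDensity (fun w : Fin m → ℝ =>
        ENNReal.ofReal ((Real.sqrt (2 * Real.pi))⁻¹ ^ m * Real.exp (-(∑ i, w i ^ 2) / 2))) := by
  refine Measure.pi_eq (fun s hs => ?_)
  have hp : ∀ w : Fin m → ℝ, (Real.sqrt (2 * Real.pi))⁻¹ ^ m * Real.exp (-(∑ i, w i ^ 2) / 2)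
      = ∏ i, gaussianPDFReal 0 1 (w i) := by
    intro w
    simp only [gaussianPDFReal, Finset.prod_mul_distrib, ← Real.exp_sum]
    simp [Finset.sum_div, neg_div]
  simp only [hp]
  rw [withDensity_apply _ (MeasurableSet.univ_pi hs), volume_pi, Measure.restrict_pi_pi]
  rw [← ofReal_integral_eq_lintegral_ofReal]
  · rw [integral_fintype_prod_eq_prod, ENNReal.ofReal_prod_of_nonneg]
    · simp only [gaussianReal_apply_eq_integral 0 one_ne_zero]
    · intro i _
      exact integral_nonneg (fun x => gaussianPDFReal_nonneg _ _ _)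
  · exact Integrable.fintype_prod (fun i => (integrable_gaussianPDFReal 0 1).restrict)
  · exact ae_of_all _ (fun x => Finset.prod_nonneg (fun i _ => gaussianPDFReal_nonneg _ _ _))

lemma st_slice (r η : ℝ) (hr : 0 < r) (hη : 0 < η) :
    gaussianReal 0 1 {a | |a| / r ≤ η} =
      ∫⁻ t in Set.Icc (-η) η,
        ENNReal.ofReal (r * ((Real.sqrt (2 * Real.pi))⁻¹ * Real.exp (-(t * r) ^ 2 / 2))) := by
  have hset : {a : ℝ | |a| / r ≤ η} = Set.Icc (-η * r) (η * r) := by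
    ext a
    rw [Set.mem_ofPred_eq, div_le_iff₀ hr, abs_le, Set.mem_Icc, neg_mul]
  have hc : Continuous fun t : ℝ =>
      r * ((Real.sqrt (2 * Real.pi))⁻¹ * Real.exp (-(t * r) ^ 2 / 2)) := by fun_prop
  rw [hset, gaussianReal_apply_eq_integral 0 one_ne_zero,
    ← ofReal_integral_eq_lintegral_ofReal (hc.integrableOn_Icc)
      (ae_of_all _ (fun x => by positivity))]
  congr 1
  rw [integral_Icc_eq_integral_Ioc, integral_Icc_eq_integral_Ioc,
    ← intervalIntegral.integral_of_le (by nlinarith), ← intervalIntegral.integral_of_le (by linarith),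
    ← intervalIntegral.mul_integral_comp_mul_right, ← intervalIntegral.integral_const_mul]
  simp [gaussianPDFReal]

lemma st_inner (m : ℕ) (hm : 1 ≤ m) (t : ℝ) :
    ∫⁻ w, ENNReal.ofReal (Real.sqrt ((∑ i, w i ^ 2) / m) * ((Real.sqrt (2 * Real.pi))⁻¹ *
        Real.exp (-(t * Real.sqrt ((∑ i, w i ^ 2) / m)) ^ 2 / 2)))
      ∂(Measure.pi fun _ : Fin m => gaussianReal 0 1) = ENNReal.ofReal (tPDF m t) := by
  have hmR : (0 : ℝ) < m := by exact_mod_cast hm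
  have hb : 0 < (1 + t ^ 2 / m) / 2 := by positivity
  have hI := st_norm_integral m hm _ hb
  have hGp : 0 < Real.Gamma ((m : ℝ) / 2) := Real.Gamma_pos_of_pos (by positivity)
  have hGp' : 0 < Real.Gamma (((m : ℝ) + 1) / 2) := Real.Gamma_pos_of_pos (by positivity)
  have hint : Integrable (fun w : EuclideanSpace ℝ (Fin m) =>
      ‖w‖ * Real.exp (-((1 + t ^ 2 / m) / 2) * ‖w‖ ^ 2)) :=
    Integrable.of_integral_ne_zero (by rw [hI]; positivity)
  rw [st_pi_density, lintegral_withDensity_eq_lintegral_mul _ (by fun_prop) (by fun_prop)]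
  set C : ℝ := (Real.sqrt (2 * Real.pi))⁻¹ ^ (m + 1) / Real.sqrt m with hC
  have key : ∀ w : Fin m → ℝ, ((fun w : Fin m → ℝ =>
        ENNReal.ofReal ((Real.sqrt (2 * Real.pi))⁻¹ ^ m * Real.exp (-(∑ i, w i ^ 2) / 2))) *
      fun w : Fin m → ℝ => ENNReal.ofReal (Real.sqrt ((∑ i, w i ^ 2) / m) *
        ((Real.sqrt (2 * Real.pi))⁻¹ *
        Real.exp (-(t * Real.sqrt ((∑ i, w i ^ 2) / m)) ^ 2 / 2)))) w =
      (fun v : EuclideanSpace ℝ (Fin m) => ENNReal.ofReal (C *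
        (‖v‖ * Real.exp (-((1 + t ^ 2 / m) / 2) * ‖v‖ ^ 2)))) (WithLp.toLp 2 w) := by
    intro w
    simp only [Pi.mul_apply]
    rw [← ENNReal.ofReal_mul (by positivity)]
    congr 1
    have hs : 0 ≤ ∑ i, w i ^ 2 := Finset.sum_nonneg (fun i _ => sq_nonneg _)
    have hn : ‖(WithLp.toLp 2 w : EuclideanSpace ℝ (Fin m))‖ = Real.sqrt (∑ i, w i ^ 2) := by
      simp [EuclideanSpace.norm_eq]
    rw [hn, mul_pow, Real.sq_sqrt (by positivity), Real.sq_sqrt hs, Real.sqrt_div hs]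
    have he : Real.exp (-((1 + t ^ 2 / m) / 2) * ∑ i, w i ^ 2) =
        Real.exp (-(∑ i, w i ^ 2) / 2) * Real.exp (-(t ^ 2 * ((∑ i, w i ^ 2) / m)) / 2) := by
      rw [← Real.exp_add]; congr 1; ring
    rw [he, hC]
    ring
  rw [lintegral_congr key, (PiLp.volume_preserving_toLp (Fin m)).lintegral_comp
      (f := fun v : EuclideanSpace ℝ (Fin m) => ENNReal.ofReal (C *
        (‖v‖ * Real.exp (-((1 + t ^ 2 / m) / 2) * ‖v‖ ^ 2)))) (by fun_prop),
    ← ofReal_integral_eq_lintegral_ofReal (hint.const_mul _)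
      (ae_of_all _ (fun x => by positivity)), integral_const_mul, hI]
  congr 1
  rw [tPDF, hC, Real.div_rpow (by positivity) (by norm_num)]
  have h2 : (2 : ℝ) ^ (-((m : ℝ) + 1) / 2) = (Real.sqrt 2)⁻¹ ^ (m + 1) := by
    rw [neg_div, Real.rpow_neg (by norm_num), inv_pow, Real.sqrt_eq_rpow, ← Real.rpow_natCast,
      ← Real.rpow_mul (by norm_num)]
    congr 2; push_cast; ring
  rw [h2, Real.sqrt_mul (by norm_num), Real.sqrt_mul hmR.le]
  have := Real.sqrt_pos.2 Real.pi_pos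
  have := Real.sqrt_pos.2 hmR
  have : 0 < Real.sqrt 2 := by positivity
  generalize (1 + t ^ 2 / (m : ℝ)) ^ (-((m : ℝ) + 1) / 2) = X
  simp only [mul_inv, mul_pow, inv_pow, pow_succ]
  field_simp

lemma st_prod (m : ℕ) (hm : 1 ≤ m) (η : ℝ) (hη : 0 < η) :
    (Measure.pi fun _ : Fin (m + 1) => gaussianReal 0 1)
      {y | |y 0| / Real.sqrt ((∑ i : Fin m, y i.succ ^ 2) / m) ≤ η} =
      ENNReal.ofReal (∫ t in (-η)..η, tPDF m t) := by
  have hmR : (0 : ℝ) < m := by exact_mod_cast hm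
  have : Nonempty (Fin m) := ⟨⟨0, hm⟩⟩
  have hmp := measurePreserving_piFinSuccAbove (fun _ : Fin (m + 1) => gaussianReal 0 1) 0
  set A : Set (ℝ × (Fin m → ℝ)) := {p | |p.1| / Real.sqrt ((∑ i : Fin m, p.2 i ^ 2) / m) ≤ η}
    with hA
  have hAm : MeasurableSet A := measurableSet_le (by fun_prop) (by fun_prop)
  have hpre : {y : Fin (m + 1) → ℝ | |y 0| / Real.sqrt ((∑ i : Fin m, y i.succ ^ 2) / m) ≤ η} =
      (MeasurableEquiv.piFinSuccAbove (fun _ : Fin (m + 1) => ℝ) 0) ⁻¹' A := by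
    ext y
    simp [hA, MeasurableEquiv.piFinSuccAbove, Fin.insertNthEquiv, Fin.tail]
  rw [hpre, hmp.measure_preimage hAm.nullMeasurableSet, Measure.prod_apply_symm hAm]
  have hns : NullSingletonClass (gaussianReal 0 1) := nullSingletonClass_gaussianReal one_ne_zero
  have hae : ∀ᵐ w ∂(Measure.pi fun _ : Fin m => gaussianReal 0 1), w ≠ 0 := by
    rw [ae_iff]
    simp
  have h1 : ∫⁻ w, gaussianReal 0 1 ((fun x => (x, w)) ⁻¹' A)
        ∂(Measure.pi fun _ : Fin m => gaussianReal 0 1) =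
      ∫⁻ w, (∫⁻ t in Set.Icc (-η) η, ENNReal.ofReal (Real.sqrt ((∑ i, w i ^ 2) / m) *
        ((Real.sqrt (2 * Real.pi))⁻¹ *
          Real.exp (-(t * Real.sqrt ((∑ i, w i ^ 2) / m)) ^ 2 / 2))))
        ∂(Measure.pi fun _ : Fin m => gaussianReal 0 1) := by
    refine lintegral_congr_ae ?_
    filter_upwards [hae] with w hw
    rw [← st_slice _ _ _ hη]
    · rfl
    · refine Real.sqrt_pos.2 (div_pos ?_ hmR)
      obtain ⟨i, hi⟩ := Function.ne_iff.1 hw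
      exact Finset.sum_pos' (fun i _ => sq_nonneg _) ⟨i, Finset.mem_univ _, by
        have : w i ≠ 0 := hi
        positivity⟩
  refine h1.trans ?_
  rw [lintegral_lintegral_swap (by fun_prop)]
  simp only [st_inner m hm]
  have hc : Continuous (tPDF m) := by
    unfold tPDF
    refine continuous_const.mul (Continuous.rpow_const (by fun_prop) (fun x => Or.inl ?_))
    positivity
  have hpos : ∀ t, 0 ≤ tPDF m t := by
    intro t
    have hGp : 0 < Real.Gamma ((m : ℝ) / 2) := Real.Gamma_pos_of_pos (by positivity)
    have hGp' : 0 < Real.Gamma (((m : ℝ) + 1) / 2) := Real.Gamma_pos_of_pos (by positivity)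
    unfold tPDF
    positivity
  rw [← ofReal_integral_eq_lintegral_ofReal (hc.integrableOn_Icc) (ae_of_all _ hpos),
    integral_Icc_eq_integral_Ioc, ← intervalIntegral.integral_of_le (by linarith)]

lemma st_rot (m : ℕ) : ∃ R : (Fin (m + 1) → ℝ) → (Fin (m + 1) → ℝ),
    MeasurePreserving R (Measure.pi fun _ : Fin (m + 1) => gaussianReal 0 1)
      (Measure.pi fun _ : Fin (m + 1) => gaussianReal 0 1) ∧
    (∀ x, R x 0 = (∑ i, x i) / Real.sqrt (m + 1)) ∧
    ∀ x, ∑ i, R x i ^ 2 = ∑ i, x i ^ 2 := by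
  have hsq : (0 : ℝ) < m + 1 := by positivity
  let v : Fin (m + 1) → EuclideanSpace ℝ (Fin (m + 1)) :=
    fun _ => WithLp.toLp 2 (fun _ => (Real.sqrt (m + 1))⁻¹)
  have hv : Orthonormal ℝ (({0} : Set (Fin (m + 1))).domRestrict v) := by
    refine ⟨fun i => ?_, fun i j hij => (hij (Subsingleton.elim _ _)).elim⟩
    simp [v, EuclideanSpace.norm_eq, Real.sq_sqrt hsq.le, hsq.ne']
  obtain ⟨b, hb⟩ := hv.exists_orthonormalBasis_extension_of_card_eq (by simp)
  have hb0 := hb 0 rfl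
  have e1 : MeasurePreserving (WithLp.toLp 2)
      (Measure.pi fun _ : Fin (m + 1) => gaussianReal 0 1)
      (stdGaussian (EuclideanSpace ℝ (Fin (m + 1)))) := ⟨by fun_prop, map_pi_eq_stdGaussian⟩
  have e2 : MeasurePreserving b.repr (stdGaussian (EuclideanSpace ℝ (Fin (m + 1))))
      (stdGaussian (EuclideanSpace ℝ (Fin (m + 1)))) :=
    ⟨b.repr.continuous.measurable, stdGaussian_map b.repr⟩
  have e3 : MeasurePreserving (WithLp.ofLp) (stdGaussian (EuclideanSpace ℝ (Fin (m + 1))))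
      (Measure.pi fun _ : Fin (m + 1) => gaussianReal 0 1) := by
    refine ⟨by fun_prop, ?_⟩
    rw [← map_pi_eq_stdGaussian, Measure.map_map (by fun_prop) (by fun_prop)]
    exact Measure.map_id
  refine ⟨fun x => WithLp.ofLp (b.repr (WithLp.toLp 2 x)), e3.comp (e2.comp e1), fun x => ?_,
    fun x => ?_⟩
  · simp only [OrthonormalBasis.repr_apply_apply, hb0]
    simp [v, PiLp.inner_apply, Finset.sum_mul, div_eq_mul_inv]
  · rw [← EuclideanSpace.real_norm_sq_eq, b.repr.norm_map, EuclideanSpace.real_norm_sq_eq]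

lemma st_std (m : ℕ) (hm : 1 ≤ m) (η : ℝ) (hη : 0 < η) :
    (Measure.pi fun _ : Fin (m + 1) => gaussianReal 0 1)
      {x | Real.sqrt (m + 1) * |(∑ k, x k) / (m + 1)| /
        Real.sqrt ((∑ k, (x k - (∑ j, x j) / (m + 1)) ^ 2) / m) ≤ η} =
      ENNReal.ofReal (∫ t in (-η)..η, tPDF m t) := by
  obtain ⟨R, hR, h0, hs⟩ := st_rot m
  rw [← st_prod m hm η hη, ← hR.measure_preimage
    (s := {y | |y 0| / Real.sqrt ((∑ i : Fin m, y i.succ ^ 2) / m) ≤ η})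
    (measurableSet_le (by fun_prop) (by fun_prop)).nullMeasurableSet]
  congr 1
  ext x
  have hp : (0 : ℝ) < m + 1 := by positivity
  have hq := Real.sq_sqrt hp.le
  have hq0 := Real.sqrt_pos.2 hp
  have ha : Real.sqrt (m + 1) * |(∑ k, x k) / (m + 1)| = |R x 0| := by
    rw [h0, abs_div, abs_div, abs_of_pos hp, abs_of_pos hq0]
    field_simp
    rw [hq]
  have hS : ∑ k, (x k - (∑ j, x j) / (m + 1)) ^ 2 = ∑ i : Fin m, R x i.succ ^ 2 := by
    have h1 := hs x
    rw [Fin.sum_univ_succ (fun i => R x i ^ 2), h0, div_pow, hq] at h1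
    simp only [sub_sq, Finset.sum_add_distrib, Finset.sum_sub_distrib, ← Finset.sum_mul,
      ← Finset.mul_sum, ← h1]
    simp
    field_simp
    ring
  simp only [Set.mem_ofPred_eq, Set.mem_preimage]
  rw [ha, hS]

/-- the Student statistic `√n (μ̄(x) − μ)/σ̄'(x)` has
Student's t-distribution with `n − 1` degrees of freedom; in particular the
probability does not depend on `(μ, σ)`. -/
theorem student_statistic_prob
    (n : ℕ) (hn : 2 ≤ n) (μ σ η : ℝ) (hσ : 0 < σ) (hη : 0 < η) :
    (Measure.pi fun _ : Fin n => gaussianReal μ (Real.toNNReal (σ ^ 2)))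
        {x : Fin n → ℝ |
          Real.sqrt n * |(∑ k, x k) / n - μ| /
            Real.sqrt ((∑ k, (x k - (∑ j, x j) / n) ^ 2) / (n - 1)) ≤ η}
      = ENNReal.ofReal (∫ t in (-η)..η, tPDF (n - 1) t) := by
  obtain ⟨m, rfl⟩ : ∃ m, n = m + 1 := ⟨n - 1, by omega⟩
  have hm : 1 ≤ m := by omega
  have hp : (0 : ℝ) < m + 1 := by positivity
  simp only [Nat.add_sub_cancel]
  rw [← st_std m hm η hη]
  have g1 : MeasurePreserving (fun z : ℝ => σ * z + μ) (gaussianReal 0 1)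
      (gaussianReal μ (Real.toNNReal (σ ^ 2))) := by
    refine ⟨by fun_prop, ?_⟩
    have : (fun z : ℝ => σ * z + μ) = (· + μ) ∘ (σ * ·) := rfl
    rw [this, ← Measure.map_map (by fun_prop) (by fun_prop), gaussianReal_map_const_mul,
      gaussianReal_map_add_const]
    congr 1
    · simp
    · ext; simp [sq_nonneg]
  have g2 := measurePreserving_pi (fun _ : Fin (m + 1) => gaussianReal 0 1)
    (fun _ : Fin (m + 1) => gaussianReal μ (Real.toNNReal (σ ^ 2))) (fun _ => g1)
  rw [← g2.measure_preimage (measurableSet_le (by fun_prop) (by fun_prop)).nullMeasurableSet]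
  congr 1
  ext x
  have hmean : (∑ k, (σ * x k + μ)) / (m + 1) = σ * ((∑ k, x k) / (m + 1)) + μ := by
    simp [Finset.sum_add_distrib, ← Finset.mul_sum]
    field_simp
  simp only [Set.mem_ofPred_eq, Set.mem_preimage, Nat.cast_add, Nat.cast_one, hmean,
    add_sub_cancel_right, add_sub_add_right_eq_sub, ← mul_sub, mul_pow, ← Finset.mul_sum,
    mul_div_assoc, abs_mul, abs_of_pos hσ]
  rw [Real.sqrt_mul (sq_nonneg _), Real.sqrt_sq hσ.le, ← mul_div_assoc σ, mul_div_mul_left _ _ hσ.ne']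
end

section
/- Let n ≥ 2 and γ ∈ (0,1), and let η' > 0 satisfy ∫_{(n−1)·e^{−2η'}}^{(n−1)·e^{2η'}} p^{χ²}_{n−1}(x) dx = γ. Then for every μ ∈ ℝ and σ > 0, N^n_{(μ,σ)}({x ∈ ℝⁿ : (e^{−2η'}/(n−1))·S̄(x) ≤ σ² ≤ (e^{2η'}/(n−1))·S̄(x)}) = γ. -/
open MeasureTheory ProbabilityTheory

lemma ci_meas {X : Type*} [MeasurableSpace X] {f₁ g₁ f₂ g₂ : X → ℝ} (h₁ : Measurable f₁)
    (h₂ : Measurable g₁) (h₃ : Measurable f₂) (h₄ : Measurable g₂) :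
    MeasurableSet {x | f₁ x ≤ g₁ x ∧ f₂ x ≤ g₂ x} :=
  (measurableSet_le h₁ h₂).inter (measurableSet_le h₃ h₄)

section CI
open Module

variable {V : Type*} [NormedAddCommGroup V] [InnerProductSpace ℝ V] [FiniteDimensional ℝ V]
  [MeasurableSpace V] [BorelSpace V]

lemma ci_integrable : Integrable (fun v : V => Real.exp (-(1/2) * ‖v‖ ^ 2)) := by
  have h := (GaussianFourier.integrable_cexp_neg_mul_sq_norm_add (V := V) (b := ((1/2 : ℝ) : ℂ))
    (by norm_num) 0 0).re
  refine h.congr (Filter.Eventually.of_forall fun v => ?_)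
  have : (-(((1/2 : ℝ)) : ℂ) * (‖v‖ : ℂ) ^ 2 + 0 * ((inner ℝ (0:V) v : ℝ) : ℂ))
      = ((-(1/2) * ‖v‖ ^ 2 : ℝ) : ℂ) := by push_cast; ring
  show (Complex.exp _).re = _
  rw [this, Complex.exp_ofReal_re]

lemma ci_density : stdGaussian V = (volume : Measure V).withDensity
    (fun v => ENNReal.ofReal ((2 * Real.pi) ^ (-(finrank ℝ V : ℝ) / 2) *
      Real.exp (-(1/2) * ‖v‖ ^ 2))) := by
  have hfin : IsFiniteMeasure ((volume : Measure V).withDensity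
    (fun v => ENNReal.ofReal ((2 * Real.pi) ^ (-(finrank ℝ V : ℝ) / 2) *
      Real.exp (-(1/2) * ‖v‖ ^ 2)))) :=
    isFiniteMeasure_withDensity_ofReal (ci_integrable.const_mul _).2
  apply Measure.ext_of_charFun
  ext t
  rw [charFun_stdGaussian, charFun_apply,
    integral_withDensity_eq_integral_toReal_smul (by fun_prop) (by simp)]
  have h := GaussianFourier.integral_cexp_neg_mul_sq_norm_add (V := V) (b := ((1/2 : ℝ) : ℂ))
    (by norm_num) Complex.I t
  have h2 : ∀ v : V, (ENNReal.ofReal ((2 * Real.pi) ^ (-(finrank ℝ V : ℝ) / 2) *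
      Real.exp (-(1/2) * ‖v‖ ^ 2))).toReal • Complex.exp ((inner ℝ v t : ℝ) * Complex.I)
      = (((2 * Real.pi) ^ (-(finrank ℝ V : ℝ) / 2) : ℝ) : ℂ) *
        Complex.exp (-((1/2 : ℝ) : ℂ) * ‖v‖ ^ 2 + Complex.I * (inner ℝ t v : ℝ)) := by
    intro v
    rw [ENNReal.toReal_ofReal (by positivity), Complex.real_smul, Complex.exp_add,
      real_inner_comm]
    push_cast
    ring_nf
  simp_rw [h2]
  rw [integral_const_mul, h]
  have h3 : ((Real.pi : ℂ) / ((1/2 : ℝ) : ℂ)) ^ ((finrank ℝ V : ℂ) / 2)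
      = (((2 * Real.pi) ^ ((finrank ℝ V : ℝ) / 2) : ℝ) : ℂ) := by
    rw [Complex.ofReal_cpow (by positivity)]
    push_cast
    congr 1
    ring
  rw [h3, ← mul_assoc, ← Complex.ofReal_mul, ← Real.rpow_add (by positivity)]
  rw [show -(finrank ℝ V : ℝ) / 2 + (finrank ℝ V : ℝ) / 2 = 0 by ring]
  simp
  congr 1
  ring

lemma ci_const (m : ℕ) (hm : 0 < m) :
    (m : ℝ) * (√Real.pi ^ m / Real.Gamma (m / 2 + 1)) * (2 * Real.pi) ^ (-(m : ℝ) / 2)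
      = 2 / (2 ^ ((m : ℝ) / 2) * Real.Gamma ((m : ℝ) / 2)) := by
  have hm' : (0 : ℝ) < m := by exact_mod_cast hm
  have hG := Real.Gamma_pos_of_pos (show (0 : ℝ) < m / 2 by positivity)
  rw [Real.Gamma_add_one (by positivity), Real.sqrt_eq_rpow, ← Real.rpow_natCast,
    ← Real.rpow_mul Real.pi_pos.le, neg_div, Real.rpow_neg (by positivity),
    Real.mul_rpow (by norm_num) Real.pi_pos.le,
    show (1/2 : ℝ) * m = m / 2 by ring]
  have := Real.rpow_pos_of_pos Real.pi_pos ((m : ℝ)/2)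
  field_simp

lemma ci_chi [Nontrivial V] (a b : ℝ) (ha : 0 < a) (hab : a ≤ b) :
    stdGaussian V {v | a ≤ ‖v‖ ^ 2 ∧ ‖v‖ ^ 2 ≤ b} =
      ENNReal.ofReal (∫ t in a..b, chiSqPDF (finrank ℝ V) t) := by
  set m := finrank ℝ V with hmdef
  have hm : 0 < m := finrank_pos
  have hS : MeasurableSet {v : V | a ≤ ‖v‖ ^ 2 ∧ ‖v‖ ^ 2 ≤ b} := by
    refine ci_meas ?_ ?_ ?_ ?_ <;> fun_prop
  rw [ci_density, withDensity_apply _ hS, ← ofReal_integral_eq_lintegral_ofReal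
    (ci_integrable.const_mul _).integrableOn (Filter.Eventually.of_forall fun v => by positivity),
    ← integral_indicator hS]
  congr 1
  set c : ℝ := (2 * Real.pi) ^ (-(m : ℝ) / 2) with hc
  have h1 := integral_fun_norm_addHaar (volume : Measure V)
    (fun r : ℝ => (Set.Icc a b).indicator (fun s => c * Real.exp (-(1/2) * s)) (r ^ 2))
  have h2 : ∀ v : V, ({v : V | a ≤ ‖v‖ ^ 2 ∧ ‖v‖ ^ 2 ≤ b}).indicator
      (fun v => c * Real.exp (-(1/2) * ‖v‖ ^ 2)) v =
      (Set.Icc a b).indicator (fun s => c * Real.exp (-(1/2) * s)) (‖v‖ ^ 2) := by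
    intro v
    simp only [Set.indicator, Set.mem_ofPred_eq, Set.mem_Icc]
  simp_rw [h2]
  rw [h1, measureReal_def, InnerProductSpace.volume_ball]
  rw [intervalIntegral.integral_of_le hab, ← integral_Icc_eq_integral_Ioc,
    ← integral_indicator measurableSet_Icc]
  have h3 : ∫ t, (Set.Icc a b).indicator (chiSqPDF m) t =
      ∫ t in Set.Ioi 0, (Set.Icc a b).indicator (chiSqPDF m) t := by
    refine (setIntegral_eq_integral_of_forall_compl_eq_zero fun x hx => ?_).symm
    apply Set.indicator_of_notMem
    simp only [Set.mem_Ioi, not_lt] at hx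
    intro h
    linarith [h.1]
  have hG := Real.Gamma_pos_of_pos (show (0 : ℝ) < m / 2 + 1 by positivity)
  rw [h3, ← integral_comp_rpow_Ioi_of_pos (g := (Set.Icc a b).indicator (chiSqPDF m)) (p := 2) (by norm_num)]
  simp only [ENNReal.ofReal_one, one_pow, one_mul, ← hmdef]
  rw [ENNReal.toReal_ofReal (by positivity), nsmul_eq_mul, smul_eq_mul, ← mul_assoc,
    ← integral_const_mul]
  refine setIntegral_congr_fun measurableSet_Ioi fun r hr => ?_
  have hr : 0 < r := hr
  simp only [smul_eq_mul, Real.rpow_two]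
  by_cases h : r ^ 2 ∈ Set.Icc a b
  · rw [Set.indicator_of_mem h, Set.indicator_of_mem h, chiSqPDF]
    have hk := ci_const m hm
    have e1 : (r ^ 2) ^ ((m : ℝ) / 2 - 1) * r = r ^ (m - 1) := by
      rw [← Real.rpow_two, ← Real.rpow_mul hr.le, ← Real.rpow_natCast r (m-1),
        ← Real.rpow_add_one hr.ne']
      congr 1
      rw [Nat.cast_sub hm]; push_cast; ring
    rw [show (2:ℝ) - 1 = 1 by norm_num, Real.rpow_one, ← e1]
    rw [show -(1/2) * r ^ 2 = -r^2/2 by ring]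
    linear_combination ((r ^ 2) ^ ((m : ℝ) / 2 - 1) * r * Real.exp (-r^2/2)) * hk
  · rw [Set.indicator_of_notMem h, Set.indicator_of_notMem h]
    simp

lemma ci_proj (K : Submodule ℝ V) :
    (stdGaussian V).map K.orthogonalProjectionOnto = stdGaussian K := by
  have : IsProbabilityMeasure ((stdGaussian V).map K.orthogonalProjectionOnto) :=
    Measure.isProbabilityMeasure_map (by fun_prop)
  apply Measure.ext_of_charFun
  ext t
  rw [charFun_stdGaussian, charFun_apply, integral_map (by fun_prop) (by fun_prop)]
  have h := charFun_stdGaussian (t : V)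
  rw [charFun_apply] at h
  simpa using h

end CI

lemma ci_pi (n : ℕ) (μ σ : ℝ) :
    (Measure.pi fun _ : Fin n => gaussianReal μ (Real.toNNReal (σ ^ 2))) =
    (Measure.pi fun _ : Fin n => gaussianReal 0 1).map (fun x k => σ * x k + μ) := by
  have h : (gaussianReal 0 1).map (fun x => σ * x + μ) = gaussianReal μ (Real.toNNReal (σ ^ 2)) := by
    have : (fun x : ℝ => σ * x + μ) = (· + μ) ∘ (σ * ·) := rfl
    rw [this, ← Measure.map_map (by fun_prop) (by fun_prop), gaussianReal_map_const_mul,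
      gaussianReal_map_add_const]
    congr 1
    · simp
    · ext; simp [sq_nonneg]
  rw [Measure.pi_map_pi (f := fun _ x => σ * x + μ) (fun _ => by fun_prop)]
  simp_rw [h]

/-- exact coverage of the variance confidence interval built
from the unbiased estimator `√(S̄(x)/(n−1))`. -/
theorem confidence_interval_variance_unbiased
    (n : ℕ) (hn : 2 ≤ n) (γ : ℝ) (hγ : γ ∈ Set.Ioo (0 : ℝ) 1)
    (η' : ℝ) (hη' : 0 < η')
    (hηγ : ∫ t in ((n - 1 : ℕ) * Real.exp (-2 * η'))..((n - 1 : ℕ) * Real.exp (2 * η')),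
      chiSqPDF (n - 1) t = γ) :
    ∀ (μ σ : ℝ), 0 < σ →
      (Measure.pi fun _ : Fin n => gaussianReal μ (Real.toNNReal (σ ^ 2)))
          {x : Fin n → ℝ |
            Real.exp (-2 * η') / (n - 1 : ℕ) * (∑ k, (x k - (∑ j, x j) / n) ^ 2) ≤ σ ^ 2 ∧
            σ ^ 2 ≤ Real.exp (2 * η') / (n - 1 : ℕ) * (∑ k, (x k - (∑ j, x j) / n) ^ 2)}
        = ENNReal.ofReal γ := by
  intro μ σ hσ
  have hn0 : (0 : ℝ) < n := by exact_mod_cast (by omega : 0 < n)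
  have hn1 : (0 : ℝ) < (n - 1 : ℕ) := by exact_mod_cast (by omega : 0 < n - 1)
  let v : EuclideanSpace ℝ (Fin n) := WithLp.toLp 2 (fun _ => 1)
  have hv : v ≠ 0 := by
    intro h
    have := congrArg (fun w : EuclideanSpace ℝ (Fin n) => w ⟨0, by omega⟩) h
    simp [v] at this
  let K : Submodule ℝ (EuclideanSpace ℝ (Fin n)) := (Submodule.span ℝ {v})ᗮ
  have hK : Module.finrank ℝ K = n - 1 := by
    have : Fact (Module.finrank ℝ (EuclideanSpace ℝ (Fin n)) = (n - 1) + 1) := ⟨by simp; omega⟩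
    exact Submodule.finrank_orthogonal_span_singleton hv
  have : Nontrivial K := Module.nontrivial_of_finrank_pos (R := ℝ) (by omega)
  have hnorm : ∀ x : EuclideanSpace ℝ (Fin n), ‖K.orthogonalProjectionOnto x‖ ^ 2 = ∑ k, (x k - (∑ j, x j) / n) ^ 2 := by
    intro x
    have h1 : ((K.orthogonalProjectionOnto x : K) : EuclideanSpace ℝ (Fin n)) = x - ((∑ j, x j) / n) • v := by
      have := Submodule.starProjection_orthogonal_val (K := Submodule.span ℝ {v}) x
      rw [Submodule.starProjection_singleton] at this
      rw [Submodule.starProjection_apply] at this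
      rw [this]
      congr 2
      simp [v, PiLp.inner_apply, EuclideanSpace.real_norm_sq_eq]
    rw [← Submodule.norm_coe, h1, EuclideanSpace.real_norm_sq_eq]
    simp [v]
  have hmain := ci_chi (V := K) _ _ (show 0 < ((n - 1 : ℕ) : ℝ) * Real.exp (-2 * η') by positivity)
    (show ((n - 1 : ℕ) : ℝ) * Real.exp (-2 * η') ≤ ((n - 1 : ℕ) : ℝ) * Real.exp (2 * η') by
      gcongr; linarith)
  rw [hK, hηγ, ← ci_proj, ← map_pi_eq_stdGaussian, Measure.map_map (by fun_prop) (by fun_prop),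
    Measure.map_apply (by fun_prop)] at hmain
  swap
  · refine ci_meas ?_ ?_ ?_ ?_ <;> fun_prop
  rw [← hmain, ci_pi, Measure.map_apply (by fun_prop)]
  swap
  · refine ci_meas ?_ ?_ ?_ ?_ <;> fun_prop
  congr 1
  ext x
  simp only [Set.mem_preimage, Set.mem_ofPred_eq, Function.comp_apply, hnorm]
  have hs : ∑ k, (σ * x k + μ - (∑ j, (σ * x j + μ)) / n) ^ 2
      = σ ^ 2 * ∑ k, (x k - (∑ j, x j) / n) ^ 2 := by
    rw [Finset.mul_sum]
    refine Finset.sum_congr rfl fun k _ => ?_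
    rw [Finset.sum_add_distrib, ← Finset.mul_sum]
    simp
    field_simp
    ring
  rw [hs]
  generalize ∑ k, (x k - (∑ j, x j) / n) ^ 2 = S
  have hσ2 : 0 < σ ^ 2 := by positivity
  rw [show -2 * η' = -(2 * η') by ring, Real.exp_neg]
  have he := Real.exp_pos (2 * η')
  generalize Real.exp (2 * η') = e at *
  generalize ((n - 1 : ℕ) : ℝ) = N at *
  have e1 : e⁻¹ / N * (σ ^ 2 * S) ≤ σ ^ 2 ↔ S ≤ N * e := by
    rw [show e⁻¹ / N * (σ ^ 2 * S) = σ ^ 2 * (S / (N * e)) by field_simp,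
      mul_le_iff_le_one_right hσ2, div_le_one (by positivity)]
  have e2 : σ ^ 2 ≤ e / N * (σ ^ 2 * S) ↔ N * e⁻¹ ≤ S := by
    rw [show e / N * (σ ^ 2 * S) = σ ^ 2 * (S / (N * e⁻¹)) by field_simp,
      le_mul_iff_one_le_right hσ2, one_le_div (by positivity)]
  rw [e1, e2, and_comm]
end

section
/- Let n ≥ 2 and γ ∈ (0,1), and let 0 < a < b satisfy ∫_0^{a} p^{χ²}_{n−1}(x) dx = (1−γ)/2 and ∫_b^{∞} p^{χ²}_{n−1}(x) dx = (1−γ)/2. Then for every μ ∈ ℝ and σ > 0, N^n_{(μ,σ)}({x ∈ ℝⁿ : S̄(x)/b ≤ σ² ≤ S̄(x)/a}) = γ. -/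
open MeasureTheory ProbabilityTheory

lemma arg_ne_pi_of_re_pos {w : ℂ} (hw : 0 < w.re) : w.arg ≠ Real.pi := by
  intro h
  rw [Complex.arg_eq_pi_iff] at h
  linarith [h.1]

lemma cpow_pi_div (w : ℂ) (hw : 0 < w.re) :
    ((√(2 * Real.pi))⁻¹ : ℝ) * ((Real.pi : ℂ) / (w / 2)) ^ (1 / 2 : ℂ) = w ^ (-(1 / 2) : ℂ) := by
  have hw0 : w ≠ 0 := by rintro rfl; simp at hw
  have hp : (0 : ℝ) < 2 * Real.pi := by positivity
  have h1 : (Real.pi : ℂ) / (w / 2) = ((2 * Real.pi : ℝ) : ℂ) * w⁻¹ := by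
    push_cast; field_simp
  have h2 : ((2 * Real.pi : ℝ) : ℂ) ^ (1 / 2 : ℂ) = (√(2 * Real.pi) : ℝ) := by
    rw [Real.sqrt_eq_rpow, Complex.ofReal_cpow hp.le]; norm_num
  have h3 : (((2 * Real.pi : ℝ) : ℂ) * w⁻¹) ^ (1 / 2 : ℂ)
      = ((2 * Real.pi : ℝ) : ℂ) ^ (1 / 2 : ℂ) * w⁻¹ ^ (1 / 2 : ℂ) := by
    have hr : ((2 * Real.pi : ℝ) : ℂ) ≠ 0 := by exact_mod_cast hp.ne'
    have hi := inv_ne_zero hw0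
    rw [Complex.cpow_def_of_ne_zero (mul_ne_zero hr hi), Complex.cpow_def_of_ne_zero hr,
      Complex.cpow_def_of_ne_zero hi, Complex.log_ofReal_mul hp hi, ← Complex.exp_add,
      Complex.ofReal_log hp.le]
    ring_nf
  have h4 : ((√(2 * Real.pi) : ℝ) : ℂ) ≠ 0 := by
    exact_mod_cast (Real.sqrt_pos.2 hp).ne'
  rw [h1, h3, h2, Complex.inv_cpow _ _ (arg_ne_pi_of_re_pos hw), Complex.cpow_neg,
    Complex.ofReal_inv]
  field_simp

/-- charFun of the square of a standard normal -/
lemma charFun_sq_gaussian (t : ℝ) :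
    charFun ((gaussianReal 0 1).map (fun x => x ^ 2)) t
      = (1 - 2 * (t * Complex.I)) ^ (-(1 / 2) : ℂ) := by
  rw [charFun_apply_real, integral_map (by fun_prop) (by fun_prop),
    integral_gaussianReal_eq_integral_smul one_ne_zero, ← cpow_pi_div _ (by simp),
    ← integral_gaussian_complex (by simp), ← integral_const_mul]
  congr 1 with x
  simp only [gaussianPDFReal, Complex.real_smul, NNReal.coe_one, mul_one, sub_zero,
    Complex.ofReal_mul, Complex.ofReal_exp]
  rw [mul_assoc, ← Complex.exp_add]
  congr 2
  push_cast
  ring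

noncomputable def chiSqM (m : ℕ) : Measure ℝ :=
  (volume.restrict (Set.Ioi 0)).withDensity (fun x => ENNReal.ofReal (chiSqPDF m x))

lemma measurable_chiSqPDF (m : ℕ) : Measurable (chiSqPDF m) := by
  unfold chiSqPDF; fun_prop

lemma chiSqPDF_nonneg (m : ℕ) {x : ℝ} (hx : 0 < x) : 0 ≤ chiSqPDF m x := by
  unfold chiSqPDF
  have := Real.Gamma_nonneg_of_nonneg (s := (m : ℝ) / 2) (by positivity)
  positivity

lemma integral_chiSq_exp (m : ℕ) (hm : 0 < m) (t : ℝ) (ht : t < 1 / 2) :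
    ∫ x in Set.Ioi (0 : ℝ), chiSqPDF m x * Real.exp (t * x) = (1 - 2 * t) ^ (-((m : ℝ) / 2)) := by
  have hm' : (0 : ℝ) < (m : ℝ) / 2 := by positivity
  have h := Real.integral_rpow_mul_exp_neg_mul_Ioi hm' (r := 1 / 2 - t) (by linarith)
  have hG := Real.Gamma_pos_of_pos hm'
  have h2 : (0 : ℝ) < 2 ^ ((m : ℝ) / 2) := by positivity
  have : ∀ x : ℝ, chiSqPDF m x * Real.exp (t * x) =
      (2 ^ ((m : ℝ) / 2) * Real.Gamma ((m : ℝ) / 2))⁻¹ *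
        (x ^ ((m : ℝ) / 2 - 1) * Real.exp (-((1 / 2 - t) * x))) := by
    intro x
    have : Real.exp (-((1 / 2 - t) * x)) = Real.exp (-x / 2) * Real.exp (t * x) := by
      rw [← Real.exp_add]; ring_nf
    rw [this, chiSqPDF]; field_simp
  simp_rw [this]
  rw [integral_const_mul, h]
  have e : (1 - 2 * t) = 2 * (1 / 2 - t) := by ring
  rw [Real.rpow_neg (by linarith), e, Real.mul_rpow (by norm_num) (by linarith), one_div (1 / 2 - t),
    Real.inv_rpow (by linarith)]
  field_simp

lemma integrable_chiSq_exp (m : ℕ) (hm : 0 < m) (t : ℝ) (ht : t < 1 / 2) :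
    IntegrableOn (fun x => chiSqPDF m x * Real.exp (t * x)) (Set.Ioi (0 : ℝ)) := by
  by_contra h
  have h1 := integral_chiSq_exp m hm t ht
  rw [integral_undef h] at h1
  have : 0 < (1 - 2 * t) ^ (-((m : ℝ) / 2)) := Real.rpow_pos_of_pos (by linarith) _
  linarith

lemma integrable_chiSq (m : ℕ) (hm : 0 < m) :
    IntegrableOn (chiSqPDF m) (Set.Ioi (0 : ℝ)) := by
  simpa using integrable_chiSq_exp m hm 0 (by norm_num)

lemma chiSqM_apply (m : ℕ) (hm : 0 < m) {s : Set ℝ} (hs : MeasurableSet s) :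
    chiSqM m s = ENNReal.ofReal (∫ x in s ∩ Set.Ioi 0, chiSqPDF m x) := by
  rw [chiSqM, withDensity_apply _ hs, Measure.restrict_restrict hs,
    ofReal_integral_eq_lintegral_ofReal
      ((integrable_chiSq m hm).mono_set Set.inter_subset_right)]
  filter_upwards [ae_restrict_mem (hs.inter measurableSet_Ioi)] with x hx
  exact chiSqPDF_nonneg m hx.2

lemma chiSqM_prob (m : ℕ) (hm : 0 < m) : IsProbabilityMeasure (chiSqM m) := by
  constructor
  rw [chiSqM_apply m hm MeasurableSet.univ, Set.univ_inter]
  have := integral_chiSq_exp m hm 0 (by norm_num)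
  simp at this
  simp [this]

lemma mgf_chiSqM (m : ℕ) (hm : 0 < m) (t : ℝ) (ht : t < 1 / 2) :
    mgf id (chiSqM m) t = (1 - 2 * t) ^ (-((m : ℝ) / 2)) := by
  rw [mgf, chiSqM, integral_withDensity_eq_integral_toReal_smul
    (measurable_chiSqPDF m).ennreal_ofReal (by simp), ← integral_chiSq_exp m hm t ht]
  refine setIntegral_congr_fun measurableSet_Ioi fun x hx => ?_
  simp [ENNReal.toReal_ofReal (chiSqPDF_nonneg m hx)]

lemma integrableExpSet_chiSqM (m : ℕ) (hm : 0 < m) :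
    Set.Iio (1 / 2) ⊆ integrableExpSet id (chiSqM m) := by
  intro t ht
  by_contra h
  have h1 := mgf_chiSqM m hm t ht
  rw [mgf, integral_undef h] at h1
  have : 0 < (1 - 2 * t) ^ (-((m : ℝ) / 2)) :=
    Real.rpow_pos_of_pos (by linarith [Set.mem_Iio.1 ht]) _
  linarith

lemma charFun_chiSqM (m : ℕ) (hm : 0 < m) (t : ℝ) :
    charFun (chiSqM m) t = ((1 - 2 * (t * Complex.I)) ^ (-(1 / 2) : ℂ)) ^ m := by
  have := chiSqM_prob m hm
  let U : Set ℂ := {z | z.re < 1 / 2}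
  have hU : IsOpen U := isOpen_lt Complex.continuous_re continuous_const
  have hUc : IsPreconnected U := (convex_halfSpace_re_lt (1 / 2)).isPreconnected
  have hf : AnalyticOnNhd ℂ (complexMGF id (chiSqM m)) U := by
    intro z hz
    refine analyticOnNhd_complexMGF z ?_
    exact interior_maximal (integrableExpSet_chiSqM m hm) isOpen_Iio hz
  have hg : AnalyticOnNhd ℂ (fun z : ℂ => (1 - 2 * z) ^ (-((m : ℂ) / 2))) U := by
    intro z hz
    refine AnalyticAt.cpow (by fun_prop) (by fun_prop) ?_
    left
    have : z.re < 1 / 2 := hz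
    simp
    linarith
  have heq : ∃ᶠ z in nhdsWithin (0 : ℂ) {0}ᶜ,
      complexMGF id (chiSqM m) z = (fun z : ℂ => (1 - 2 * z) ^ (-((m : ℂ) / 2))) z := by
    have hreal : ∀ᶠ s : ℝ in nhdsWithin (0 : ℝ) {0}ᶜ, complexMGF id (chiSqM m) (s : ℂ)
        = (fun z : ℂ => (1 - 2 * z) ^ (-((m : ℂ) / 2))) (s : ℂ) := by
      have : ∀ᶠ s : ℝ in nhdsWithin (0 : ℝ) {0}ᶜ, s < 1 / 2 :=
        nhdsWithin_le_nhds (Iio_mem_nhds (by norm_num))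
      filter_upwards [this] with s hs
      rw [complexMGF_ofReal, mgf_chiSqM m hm s hs, Complex.ofReal_cpow (by linarith)]
      push_cast
      rfl
    have htend : Filter.Tendsto (fun s : ℝ => (s : ℂ)) (nhdsWithin (0 : ℝ) {0}ᶜ)
        (nhdsWithin (0 : ℂ) {0}ᶜ) := by
      refine tendsto_nhdsWithin_iff.2 ⟨?_, ?_⟩
      · exact (Complex.continuous_ofReal.tendsto' 0 0 (by simp)).mono_left nhdsWithin_le_nhds
      · filter_upwards [self_mem_nhdsWithin] with s hs
        simpa using hs
    exact htend.frequently hreal.frequently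
  have key := hf.eqOn_of_preconnected_of_frequently_eq hg hUc (z₀ := 0) (by simp [U]) heq
  have h := key (show (t * Complex.I : ℂ) ∈ U by simp [U])
  simp only at h
  rw [← Complex.cpow_nat_mul, show (m : ℂ) * -(1 / 2) = -((m : ℂ) / 2) by ring, ← h,
    charFun_apply_real, complexMGF]
  congr 1 with x
  simp only [id]
  ring_nf

lemma law_Q {Ω : Type*} [MeasurableSpace Ω] (P : Measure Ω) [IsProbabilityMeasure P]
    (n : ℕ) (hn : 2 ≤ n) (X : Fin n → Ω → ℝ) (hXm : ∀ i, Measurable (X i))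
    (hi : iIndepFun X P) (hl : ∀ i, P.map (X i) = gaussianReal 0 1) :
    P.map (fun ω => ∑ k, (X k ω - (∑ j, X j ω) / n) ^ 2) = chiSqM (n - 1) := by
  have hn0 : (0 : ℝ) < n := by positivity
  have hsq : √(n : ℝ) ≠ 0 := (Real.sqrt_pos.2 hn0).ne'
  have hsq2 : √(n : ℝ) ^ 2 = n := Real.sq_sqrt hn0.le
  have hG : ∀ i, HasGaussianLaw (X i) P := fun i => ⟨by rw [hl i]; infer_instance⟩
  have hGv : HasGaussianLaw (fun ω => (X · ω)) P := hi.hasGaussianLaw hG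
  have hL2 : ∀ i, MemLp (X i) 2 P := fun i => (hG i).memLp_two
  have hmean : ∀ i, ∫ ω, X i ω ∂P = 0 := fun i => by
    have h := integral_map (μ := P) (hXm i).aemeasurable (f := fun x : ℝ => x) (by fun_prop)
    rw [hl i, integral_id_gaussianReal] at h
    exact h.symm
  have hvar : ∀ i, Var[X i; P] = 1 := fun i => by
    have h := variance_map (μ := P) (X := fun x : ℝ => x) (Y := X i) (by fun_prop)
      (hXm i).aemeasurable
    rw [hl i, variance_fun_id_gaussianReal] at h
    simpa [Function.comp_def] using h.symm
  set S : Ω → ℝ := fun ω => ∑ j, X j ω with hS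
  have hSm : Measurable S := by fun_prop
  have hS2 : MemLp S 2 P := memLp_finsetSum _ fun i _ => hL2 i
  have hcov : ∀ k, cov[S, X k; P] = 1 := fun k => by
    rw [hS, covariance_fun_sum_left hL2 (hL2 k), Finset.sum_eq_single k]
    · rw [covariance_self (hXm k).aemeasurable, hvar k]
    · intro j _ hj
      exact (hi.indepFun hj).covariance_eq_zero (hL2 j) (hL2 k)
    · simp
  have hcovS : cov[S, S; P] = n := by
    conv_lhs => arg 2; rw [hS]
    rw [covariance_fun_sum_right hL2 hS2]
    simp [hcov]
  set M : Ω → ℝ := fun ω => (√(n : ℝ))⁻¹ * S ω with hM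
  have hMm : Measurable M := by fun_prop
  set D : Fin n → Ω → ℝ := fun k ω => X k ω - (n : ℝ)⁻¹ * S ω with hD
  have hDm : ∀ k, Measurable (D k) := fun k => by fun_prop
  -- independence
  let L : (Fin n → ℝ) →ₗ[ℝ] (Unit → ℝ) × (Fin n → ℝ) :=
    { toFun := fun x => (fun _ => (√(n : ℝ))⁻¹ * ∑ j, x j, fun k => x k - (n : ℝ)⁻¹ * ∑ j, x j)
      map_add' := fun x y => by
        ext <;> simp [Finset.sum_add_distrib] <;> ring
      map_smul' := fun c x => by
        ext <;> simp [← Finset.mul_sum] <;> ring }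
  have hpair : HasGaussianLaw (fun ω => ((fun _ : Unit => M ω), (fun k => D k ω))) P :=
    hGv.map (LinearMap.toContinuousLinearMap L)
  have hind := HasGaussianLaw.indepFun_of_covariance_eval (X := fun _ : Unit => M) (Y := D) hpair
    (by
      intro _ k
      rw [hM, hD, covariance_const_mul_left,
        covariance_fun_sub_right hS2 (hL2 k) (hS2.const_mul _), covariance_const_mul_right,
        hcov, hcovS]
      field_simp
      simp)
  set Q : Ω → ℝ := fun ω => ∑ k, (D k ω) ^ 2 with hQ
  have hQm : Measurable Q := by fun_prop
  have hMQ : IndepFun (fun ω => M ω ^ 2) Q P :=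
    hind.comp (φ := fun f : Unit → ℝ => f () ^ 2) (ψ := fun g : Fin n → ℝ => ∑ k, g k ^ 2)
      (by fun_prop) (by fun_prop)
  have hMlaw : P.map M = gaussianReal 0 1 := by
    have hMG : HasGaussianLaw M P := hpair.fst.eval ()
    rw [hMG.map_eq_gaussianReal]
    congr 1
    · rw [hM, integral_const_mul, hS, integral_finsetSum _ fun i _ => (hL2 i).integrable (by simp)]
      simp [hmean]
    · rw [hM, variance_const_mul, ← covariance_self hSm.aemeasurable, hcovS, inv_pow, hsq2]
      field_simp
      simp
  have hdecomp : (fun ω => M ω ^ 2) + Q = ∑ i, fun ω => X i ω ^ 2 := by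
    ext ω
    simp only [Pi.add_apply, Finset.sum_apply, hM, hQ, hD]
    have : ∀ k, (X k ω - (n : ℝ)⁻¹ * S ω) ^ 2
        = X k ω ^ 2 - 2 * ((n : ℝ)⁻¹ * S ω) * X k ω + ((n : ℝ)⁻¹ * S ω) ^ 2 := fun k => by ring
    simp_rw [this, Finset.sum_add_distrib, Finset.sum_sub_distrib, ← Finset.mul_sum]
    rw [show ∑ j, X j ω = S ω from rfl, mul_pow, inv_pow, hsq2]
    simp
    field_simp
    ring
  have hsqlaw : ∀ Y : Ω → ℝ, Measurable Y → P.map Y = gaussianReal 0 1 →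
      P.map (fun ω => Y ω ^ 2) = (gaussianReal 0 1).map (fun x => x ^ 2) := by
    intro Y hY h
    rw [← h, Measure.map_map (by fun_prop) hY]
    rfl
  have hprod := iIndepFun.charFun_map_sum_eq_prod (P := P) (X := fun i ω => X i ω ^ 2)
    (fun i => by fun_prop) (hi.comp (fun _ x => x ^ 2) (fun _ => by fun_prop))
  have hadd := hMQ.charFun_map_add_eq_mul (by fun_prop) hQm.aemeasurable
  rw [hdecomp, hprod, hsqlaw M hMm hMlaw] at hadd
  simp_rw [fun i => hsqlaw (X i) (hXm i) (hl i)] at hadd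
  have hQeq : (fun ω => ∑ k, (X k ω - (∑ j, X j ω) / n) ^ 2) = Q := by
    ext ω
    simp only [hQ, hD, hS, div_eq_inv_mul]
  have := chiSqM_prob (n - 1) (by omega)
  have := Measure.isProbabilityMeasure_map (μ := P) hQm.aemeasurable
  rw [hQeq]
  refine Measure.ext_of_charFun ?_
  ext t
  have ht := congrFun hadd t
  rw [charFun_chiSqM _ (by omega)]
  simp only [Finset.prod_const, Finset.card_univ, Fintype.card_fin, Pi.pow_apply, Pi.mul_apply,
    charFun_sq_gaussian] at ht
  have hne : (1 - 2 * ((t : ℂ) * Complex.I)) ^ (-(1 / 2) : ℂ) ≠ 0 := by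
    rw [Complex.cpow_ne_zero_iff]
    left
    intro h
    have := congrArg Complex.re h
    simp at this
  apply mul_left_cancel₀ hne
  rw [← ht, ← pow_succ', Nat.sub_add_cancel (by omega)]

/-- coverage of the conventional α-point confidence interval
for the variance. -/
theorem confidence_interval_alpha_point
    (n : ℕ) (hn : 2 ≤ n) (γ : ℝ) (hγ : γ ∈ Set.Ioo (0 : ℝ) 1)
    (a b : ℝ) (ha : 0 < a) (hab : a < b)
    (hlow : ∫ t in Set.Ioc (0 : ℝ) a, chiSqPDF (n - 1) t = (1 - γ) / 2)
    (hhigh : ∫ t in Set.Ioi b, chiSqPDF (n - 1) t = (1 - γ) / 2) :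
    ∀ (μ σ : ℝ), 0 < σ →
      (Measure.pi fun _ : Fin n => gaussianReal μ (Real.toNNReal (σ ^ 2)))
          {x : Fin n → ℝ |
            (∑ k, (x k - (∑ j, x j) / n) ^ 2) / b ≤ σ ^ 2 ∧
            σ ^ 2 ≤ (∑ k, (x k - (∑ j, x j) / n) ^ 2) / a}
        = ENNReal.ofReal γ := by
  intro μ σ hσ
  have hn0 : (n : ℝ) ≠ 0 := by positivity
  have hm : 0 < n - 1 := by omega
  have hb : 0 < b := ha.trans hab
  set P := Measure.pi fun _ : Fin n => gaussianReal μ (Real.toNNReal (σ ^ 2)) with hP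
  let X : Fin n → (Fin n → ℝ) → ℝ := fun i x => (x i - μ) / σ
  have hXm : ∀ i, Measurable (X i) := fun i => by fun_prop
  have hi : iIndepFun X P :=
    iIndepFun_pi (X := fun _ (y : ℝ) => (y - μ) / σ) (fun _ => by fun_prop)
  have hl : ∀ i, P.map (X i) = gaussianReal 0 1 := by
    intro i
    have h1 := (measurePreserving_eval
      (fun _ : Fin n => gaussianReal μ (Real.toNNReal (σ ^ 2))) i).map_eq
    have h2 : X i = (fun y => y / σ) ∘ (fun y => y - μ) ∘ Function.eval i := rfl
    rw [h2, ← Measure.map_map (by fun_prop) (by fun_prop),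
      ← Measure.map_map (by fun_prop) (by fun_prop), h1, gaussianReal_map_sub_const,
      gaussianReal_map_div_const]
    congr 1
    · simp
    · ext
      simp [Real.coe_toNNReal _ (sq_nonneg σ), hσ.ne']
  have hlaw := law_Q P n hn X hXm hi hl
  have hset : {x : Fin n → ℝ |
            (∑ k, (x k - (∑ j, x j) / n) ^ 2) / b ≤ σ ^ 2 ∧
            σ ^ 2 ≤ (∑ k, (x k - (∑ j, x j) / n) ^ 2) / a}
      = (fun x => ∑ k, (X k x - (∑ j, X j x) / n) ^ 2) ⁻¹' Set.Icc a b := by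
    ext x
    have : ∑ k, (X k x - (∑ j, X j x) / n) ^ 2
        = (∑ k, (x k - (∑ j, x j) / n) ^ 2) / σ ^ 2 := by
      conv_rhs => rw [Finset.sum_div]
      refine Finset.sum_congr rfl fun k _ => ?_
      simp only [X, ← Finset.sum_div, Finset.sum_sub_distrib, Finset.sum_const, Finset.card_univ,
        Fintype.card_fin, nsmul_eq_mul]
      field_simp
      ring
    have hs2 : 0 < σ ^ 2 := by positivity
    simp only [Set.mem_ofPred_eq, Set.mem_preimage, Set.mem_Icc, this]
    rw [div_le_iff₀ hb, le_div_iff₀ ha, le_div_iff₀ hs2, div_le_iff₀ hs2, mul_comm a, mul_comm b]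
    exact and_comm
  rw [hset, ← Measure.map_apply (by fun_prop) measurableSet_Icc, hlaw,
    chiSqM_apply _ hm measurableSet_Icc]
  congr 1
  have hint := integrable_chiSq (n - 1) hm
  have htot : ∫ x in Set.Ioi (0 : ℝ), chiSqPDF (n - 1) x = 1 := by
    simpa using integral_chiSq_exp (n - 1) hm 0 (by norm_num)
  have e1 : Set.Icc a b ∩ Set.Ioi 0 = Set.Icc a b :=
    Set.inter_eq_left.2 fun x hx => ha.trans_le hx.1
  rw [e1, integral_Icc_eq_integral_Ioc]
  have s1 : Set.Ioc 0 a ∪ Set.Ioi a = Set.Ioi 0 := Set.Ioc_union_Ioi_eq_Ioi ha.le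
  have s2 : Set.Ioc a b ∪ Set.Ioi b = Set.Ioi a := Set.Ioc_union_Ioi_eq_Ioi hab.le
  have u1 := setIntegral_union (μ := volume) (f := chiSqPDF (n - 1))
    (Set.Ioc_disjoint_Ioi (le_refl a)) measurableSet_Ioi
    (hint.mono_set fun x (hx : x ∈ Set.Ioc 0 a) => hx.1)
    (hint.mono_set fun x (hx : a < x) => ha.trans hx)
  have u2 := setIntegral_union (μ := volume) (f := chiSqPDF (n - 1))
    (Set.Ioc_disjoint_Ioi (le_refl b)) measurableSet_Ioi
    (hint.mono_set fun x (hx : x ∈ Set.Ioc a b) => ha.trans hx.1)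
    (hint.mono_set fun x (hx : b < x) => hb.trans hx)
  rw [s1] at u1
  rw [s2] at u2
  linarith
end
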